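/- Assume either 0<α_i<q^{−1} for all i, or α_i>q^{−N} for all i. For 0≤n≤N let W_n = R_{N−1}R_{N−2}⋯R_n[Ker L_n] ⊆ V_{h,N} (so W_N = Ker L_N). Then: (i) every f∈W_n satisfies D_N f = q^{−n}(1−q^n)(1−A_h q^{n+h−1})·f; (ii) the subspaces W_0, W_1, …, W_N are pairwise orthogonal with respect to ⟨·,·⟩_{V_{h,N}}, and V_{h,N} is their (internal) direct sum. -/

import Mathlib

open Finset

noncomputable section

/-- q-shifted factorial `(a;q)_m`. -/
def qPoch (q a : ℝ) (m : ℕ) : ℝ := ∏ k ∈ Finset.range m, (1 - a * q ^ k)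

/-- Partial sum `X_k = x_1 + ⋯ + x_k` (entries of index `< k`, 0-indexed). -/
def Xlt {h : ℕ} (x : Fin h → ℕ) (k : ℕ) : ℕ := ∑ j : Fin h, if (j : ℕ) < k then x j else 0

/-- Partial product `A_k = α_1 ⋯ α_k` (entries of index `< k`, 0-indexed). -/
def Apar {h : ℕ} (α : Fin h → ℝ) (k : ℕ) : ℝ := ∏ j : Fin h, if (j : ℕ) < k then α j else 1

/-- Raising operator `R_N : V_{h,N} → V_{h,N+1}`. -/
def Rop (q : ℝ) {h : ℕ} (N : ℕ) (f : (Fin h → ℕ) → ℂ) : (Fin h → ℕ) → ℂ := fun x =>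
  ∑ i : Fin h, (q : ℂ) ^ ((Xlt x i : ℤ) - N - 1) * (1 - (q : ℂ) ^ (x i)) *
    f (Function.update x i (x i - 1))

/-- Lowering operator `L_N : V_{h,N} → V_{h,N-1}` (its defining formula does not involve `N`). -/
def Lop (q : ℝ) {h : ℕ} (α : Fin h → ℝ) (f : (Fin h → ℕ) → ℂ) : (Fin h → ℕ) → ℂ := fun x =>
  ∑ j : Fin h, ((Apar α j : ℝ) : ℂ) * (q : ℂ) ^ ((j : ℕ) + Xlt x j) *
    ((α j : ℂ) * (q : ℂ) ^ (x j + 1) - 1) * f (Function.update x j (x j + 1))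

/-- The multidimensional q-Hahn operator `D_N : V_{h,N} → V_{h,N}`. -/
def Dop (q : ℝ) {h : ℕ} (α : Fin h → ℝ) (N : ℕ) (f : (Fin h → ℕ) → ℂ) : (Fin h → ℕ) → ℂ :=
  fun x =>
    (∑ i : Fin h, ∑ j : Fin h,
      if i ≠ j then
        ((Apar α j : ℝ) : ℂ) *
          (q : ℂ) ^ ((((j : ℕ) + Xlt x j + Xlt x i : ℕ) : ℤ) - N -
            (if (i : ℕ) < (j : ℕ) then 1 else 0)) *
          ((α j : ℂ) * (q : ℂ) ^ (x j + 1) - 1) * (1 - (q : ℂ) ^ (x i)) *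
          f (Function.update (Function.update x j (x j + 1)) i (x i - 1))
      else 0)
    + ((∑ j : Fin h,
          ((Apar α j : ℝ) : ℂ) * (q : ℂ) ^ ((((j : ℕ) + 2 * Xlt x j : ℕ) : ℤ) - N) *
            ((α j : ℂ) * (q : ℂ) ^ (x j) - 1) * (1 - (q : ℂ) ^ (x j)))
        + (((Apar α h : ℝ) : ℂ) * (q : ℂ) ^ (((h + N : ℕ) : ℤ) - 1) - 1) *
            (1 - (q : ℂ) ^ (-(N : ℤ)))) * f x

/-- Scalar product on `V_{h,N}`. -/
def innerV (q : ℝ) {h : ℕ} (α : Fin h → ℝ) (N : ℕ) (f g : (Fin h → ℕ) → ℂ) : ℂ :=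
  (q : ℂ) ^ (N * (N + 1) / 2) *
    ∑ x ∈ Finset.Nat.antidiagonalTuple h N,
      (∏ i : Fin h, ((qPoch q (q * α i) (x i) / qPoch q q (x i) : ℝ) : ℂ) *
        ((α i * q : ℝ) : ℂ) ^ ((N : ℤ) - Xlt x ((i : ℕ) + 1))) *
      f x * (starRingEnd ℂ) (g x)

/-- `RopIter q n k f = R_{n+k-1} ⋯ R_{n+1} R_n f`. -/
def RopIter (q : ℝ) {h : ℕ} (n : ℕ) : ℕ → ((Fin h → ℕ) → ℂ) → ((Fin h → ℕ) → ℂ)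
  | 0, f => f
  | k + 1, f => Rop q (n + k) (RopIter q n k f)

/-- The tuple `x` with its `i`-th entry increased by one. -/
def incr {h : ℕ} (x : Fin h → ℕ) (i : Fin h) : Fin h → ℕ := Function.update x i (x i + 1)

/-- The tuple `x` with its `i`-th entry decreased by one (truncated at zero). -/
def decr {h : ℕ} (x : Fin h → ℕ) (i : Fin h) : Fin h → ℕ := Function.update x i (x i - 1)

/-- The raising operator without its level-dependent scalar factor. -/
def raise (q : ℝ) {h : ℕ} (f : (Fin h → ℕ) → ℂ) : (Fin h → ℕ) → ℂ := fun x =>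
  ∑ i : Fin h, (q : ℂ) ^ Xlt x i * (1 - (q : ℂ) ^ x i) * f (decr x i)

/-- The weight of the scalar product, without its level-dependent scalar factor. -/
def weight (q : ℝ) {h : ℕ} (α : Fin h → ℝ) (N : ℕ) (x : Fin h → ℕ) : ℝ :=
  ∏ i : Fin h, qPoch q (q * α i) (x i) / qPoch q q (x i) *
    (α i * q) ^ ((N : ℤ) - Xlt x ((i : ℕ) + 1))

/-- The scalar product without its level-dependent scalar factor. -/
def form (q : ℝ) {h : ℕ} (α : Fin h → ℝ) (N : ℕ) (f g : (Fin h → ℕ) → ℂ) : ℂ :=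
  ∑ x ∈ Finset.Nat.antidiagonalTuple h N,
    (weight q α N x : ℂ) * f x * (starRingEnd ℂ) (g x)

/-- The eigenvalue of the q-Hahn operator attached to level `n`. -/
def eigval (q : ℝ) {h : ℕ} (α : Fin h → ℝ) (n : ℕ) : ℂ :=
  (((Apar α h : ℝ) : ℂ) * (q : ℂ) ^ (((h + n : ℕ) : ℤ) - 1) - 1) * (1 - (q : ℂ) ^ (-(n : ℤ)))

lemma incr_self {h : ℕ} (x : Fin h → ℕ) (i : Fin h) : incr x i i = x i + 1 := by simp [incr]

lemma incr_of_ne {h : ℕ} (x : Fin h → ℕ) {i j : Fin h} (hij : j ≠ i) : incr x i j = x j := by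
  simp [incr, hij]

lemma decr_incr {h : ℕ} (x : Fin h → ℕ) (i : Fin h) : decr (incr x i) i = x := by
  simp [incr, decr]

lemma incr_decr {h : ℕ} (x : Fin h → ℕ) (i : Fin h) (hx : x i ≠ 0) : incr (decr x i) i = x := by
  have : x i - 1 + 1 = x i := by omega
  simp [incr, decr, this]

lemma decr_incr_of_ne {h : ℕ} (x : Fin h → ℕ) {i j : Fin h} (hij : i ≠ j) :
    decr (incr x j) i = incr (decr x i) j := by
  simp [incr, decr, hij, hij.symm, Function.update_comm hij]

lemma Xlt_incr {h : ℕ} (x : Fin h → ℕ) (i : Fin h) (k : ℕ) :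
    Xlt (incr x i) k = Xlt x k + if (i : ℕ) < k then 1 else 0 := by
  have : ∀ j : Fin h, (if (j : ℕ) < k then incr x i j else 0) =
      (if (j : ℕ) < k then x j else 0) + if j = i then (if (i : ℕ) < k then 1 else 0) else 0 := by
    intro j
    by_cases hj : j = i
    · subst hj
      by_cases hk : (j : ℕ) < k <;> simp [hk, incr_self]
    · simp [hj, incr_of_ne]
  simp [Xlt, this, Finset.sum_add_distrib]

lemma sum_incr {h : ℕ} (x : Fin h → ℕ) (i : Fin h) : ∑ j, incr x i j = (∑ j, x j) + 1 := by
  have := Xlt_incr x i h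
  simpa [Xlt] using this

lemma sum_decr {h : ℕ} (x : Fin h → ℕ) (i : Fin h) (hx : x i ≠ 0) :
    (∑ j, decr x i j) + 1 = ∑ j, x j := by
  rw [← sum_incr (decr x i) i, incr_decr x i hx]

lemma Xlt_top {h : ℕ} (x : Fin h → ℕ) : Xlt x h = ∑ j, x j := by simp [Xlt]

lemma Xlt_succ {h : ℕ} (x : Fin h → ℕ) (i : Fin h) :
    Xlt x ((i : ℕ) + 1) = Xlt x i + x i := by
  have : ∀ j : Fin h, (if (j : ℕ) < i + 1 then x j else 0) =
      (if (j : ℕ) < i then x j else 0) + if j = i then x i else 0 := by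
    intro j
    rcases lt_trichotomy j i with hj | hj | hj
    · have h1 : (j : ℕ) < i := hj
      simp [h1, h1.trans (Nat.lt_succ_self _), hj.ne]
    · simp [hj]
    · have h1 : (i : ℕ) < j := hj
      simp [hj.ne', show ¬ (j : ℕ) < i + 1 by omega, show ¬ (j : ℕ) < i by omega]
  simp only [Xlt, this, Finset.sum_add_distrib]
  simp

lemma Apar_succ {h : ℕ} (α : Fin h → ℝ) (i : Fin h) :
    Apar α ((i : ℕ) + 1) = Apar α i * α i := by
  have : ∀ j : Fin h, (if (j : ℕ) < i + 1 then α j else 1) =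
      (if (j : ℕ) < i then α j else 1) * if j = i then α i else 1 := by
    intro j
    rcases lt_trichotomy j i with hj | hj | hj
    · have h1 : (j : ℕ) < i := hj
      simp [h1, h1.trans (Nat.lt_succ_self _), hj.ne]
    · simp [hj]
    · have h1 : (i : ℕ) < j := hj
      simp [hj.ne', show ¬ (j : ℕ) < i + 1 by omega, show ¬ (j : ℕ) < i by omega]
  simp only [Apar, this, Finset.prod_mul_distrib]
  simp

lemma Lop_apply (q : ℝ) {h : ℕ} (α : Fin h → ℝ) (f : (Fin h → ℕ) → ℂ) (x : Fin h → ℕ) :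
    Lop q α f x = ∑ j : Fin h, ((Apar α j : ℝ) : ℂ) * (q : ℂ) ^ ((j : ℕ) + Xlt x j) *
      ((α j : ℂ) * (q : ℂ) ^ (x j + 1) - 1) * f (incr x j) := rfl

lemma Rop_eq_smul_raise {q : ℝ} (hq : q ≠ 0) {h : ℕ} (N : ℕ) (f : (Fin h → ℕ) → ℂ) :
    Rop q N f = ((q : ℂ) ^ (N + 1))⁻¹ • raise q f := by
  have hq' : (q : ℂ) ≠ 0 := by exact_mod_cast hq
  funext x
  simp only [Rop, raise, Pi.smul_apply, smul_eq_mul, Finset.mul_sum]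
  refine Finset.sum_congr rfl fun i _ => ?_
  rw [show ((Xlt x i : ℤ) - N - 1) = (Xlt x i : ℤ) - ((N + 1 : ℕ) : ℤ) by push_cast; ring,
    zpow_sub₀ hq', zpow_natCast, zpow_natCast, decr]
  ring

lemma raise_smul (q : ℝ) {h : ℕ} (c : ℂ) (f : (Fin h → ℕ) → ℂ) :
    raise q (c • f) = c • raise q f := by
  funext x
  simp only [raise, Pi.smul_apply, smul_eq_mul, Finset.mul_sum]
  exact Finset.sum_congr rfl fun i _ => by ring

lemma raise_add (q : ℝ) {h : ℕ} (f g : (Fin h → ℕ) → ℂ) :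
    raise q (f + g) = raise q f + raise q g := by
  funext x
  simp only [raise, Pi.add_apply, ← Finset.sum_add_distrib]
  exact Finset.sum_congr rfl fun i _ => by ring

lemma Lop_smul (q : ℝ) {h : ℕ} (α : Fin h → ℝ) (c : ℂ) (f : (Fin h → ℕ) → ℂ) :
    Lop q α (c • f) = c • Lop q α f := by
  funext x
  simp only [Lop, Pi.smul_apply, smul_eq_mul, Finset.mul_sum]
  exact Finset.sum_congr rfl fun i _ => by ring

lemma raise_congr (q : ℝ) {h : ℕ} {f g : (Fin h → ℕ) → ℂ} {x : Fin h → ℕ}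
    (hfg : ∀ y : Fin h → ℕ, (∑ i, y i) + 1 = ∑ i, x i → f y = g y) :
    raise q f x = raise q g x := by
  refine Finset.sum_congr rfl fun i _ => ?_
  by_cases hx : x i = 0
  · simp [hx]
  · rw [hfg _ (sum_decr x i hx)]

lemma raise_eq_zero (q : ℝ) {h : ℕ} {f : (Fin h → ℕ) → ℂ} {x : Fin h → ℕ}
    (hf : ∀ y : Fin h → ℕ, (∑ i, y i) + 1 = ∑ i, x i → f y = 0) :
    raise q f x = 0 := by
  rw [raise_congr q (g := 0) hf]
  simp [raise]

lemma RopIter_eq_smul {q : ℝ} (hq : q ≠ 0) {h : ℕ} (n k : ℕ) :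
    ∃ c : ℂ, ∀ f : (Fin h → ℕ) → ℂ, RopIter q n k f = c • (raise q)^[k] f := by
  induction k with
  | zero => exact ⟨1, fun f => by simp [RopIter]⟩
  | succ k ih =>
    obtain ⟨c, hc⟩ := ih
    refine ⟨((q : ℂ) ^ (n + k + 1))⁻¹ * c, fun f => ?_⟩
    rw [RopIter, hc, Rop_eq_smul_raise hq, raise_smul, Function.iterate_succ_apply', smul_smul]

lemma Lop_raise_term_of_ne (q : ℝ) {h : ℕ} (α : Fin h → ℝ) (f : (Fin h → ℕ) → ℂ)
    (x : Fin h → ℕ) {i j : Fin h} (hij : i ≠ j) :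
    ((Apar α j : ℝ) : ℂ) * (q : ℂ) ^ ((j : ℕ) + Xlt x j) *
        ((α j : ℂ) * (q : ℂ) ^ (x j + 1) - 1) *
        ((q : ℂ) ^ Xlt (incr x j) i * (1 - (q : ℂ) ^ incr x j i) * f (decr (incr x j) i)) =
      q * ((q : ℂ) ^ Xlt x i * (1 - (q : ℂ) ^ x i) *
        (((Apar α j : ℝ) : ℂ) * (q : ℂ) ^ ((j : ℕ) + Xlt (decr x i) j) *
        ((α j : ℂ) * (q : ℂ) ^ (decr x i j + 1) - 1) * f (incr (decr x i) j))) := by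
  rw [incr_of_ne x hij, decr_incr_of_ne x hij]
  by_cases hx : x i = 0
  · simp [hx]
  obtain ⟨y, rfl⟩ : ∃ y, x = incr y i := ⟨_, (incr_decr x i hx).symm⟩
  have hv : (i : ℕ) ≠ j := fun e => hij (Fin.ext e)
  simp only [decr_incr, Xlt_incr, incr_self, incr_of_ne y hij.symm]
  rcases lt_or_gt_of_ne hv with hlt | hlt
  · simp only [hlt, if_true, show ¬ (j : ℕ) < i by omega, if_false, lt_irrefl]
    ring
  · simp only [hlt, if_true, show ¬ (i : ℕ) < j by omega, if_false, lt_irrefl]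
    ring

lemma Lop_raise_term_self (q : ℝ) {h : ℕ} (α : Fin h → ℝ) (f : (Fin h → ℕ) → ℂ)
    (x : Fin h → ℕ) (j : Fin h) :
    ((Apar α j : ℝ) : ℂ) * (q : ℂ) ^ ((j : ℕ) + Xlt x j) *
        ((α j : ℂ) * (q : ℂ) ^ (x j + 1) - 1) *
        ((q : ℂ) ^ Xlt (incr x j) j * (1 - (q : ℂ) ^ incr x j j) * f (decr (incr x j) j)) -
      q * ((q : ℂ) ^ Xlt x j * (1 - (q : ℂ) ^ x j) *
        (((Apar α j : ℝ) : ℂ) * (q : ℂ) ^ ((j : ℕ) + Xlt (decr x j) j) *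
        ((α j : ℂ) * (q : ℂ) ^ (decr x j j + 1) - 1) * f (incr (decr x j) j))) =
      (1 - q) * (((Apar α ((j : ℕ) + 1) : ℝ) : ℂ) *
          (q : ℂ) ^ ((j : ℕ) + 1 + 2 * Xlt x ((j : ℕ) + 1)) -
        ((Apar α j : ℝ) : ℂ) * (q : ℂ) ^ ((j : ℕ) + 2 * Xlt x j)) * f x := by
  rw [decr_incr, incr_self, Xlt_succ, Apar_succ, Xlt_incr]
  simp only [lt_irrefl, if_false, add_zero]
  by_cases hx : x j = 0
  · simp only [hx]
    push_cast
    ring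
  obtain ⟨y, rfl⟩ : ∃ y, x = incr y j := ⟨_, (incr_decr x j hx).symm⟩
  simp only [decr_incr, Xlt_incr, incr_self, lt_irrefl, if_false, add_zero]
  push_cast
  ring

/-- The q-commutation relation between the lowering and raising operators. -/
lemma Lop_raise (q : ℝ) {h : ℕ} (α : Fin h → ℝ) (f : (Fin h → ℕ) → ℂ) (x : Fin h → ℕ) :
    Lop q α (raise q f) x = q * raise q (Lop q α f) x +
      (1 - q) * (((Apar α h : ℝ) : ℂ) * (q : ℂ) ^ (h + 2 * ∑ i, x i) - 1) * f x := by
  rw [← sub_eq_iff_eq_add']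
  simp only [Lop_apply, raise, Finset.mul_sum]
  rw [Finset.sum_comm (γ := Fin h) (f := fun i j => (q : ℂ) * _)]
  rw [← Finset.sum_sub_distrib]
  simp only [← Finset.sum_sub_distrib]
  have key : ∀ j i : Fin h,
      ((Apar α j : ℝ) : ℂ) * (q : ℂ) ^ ((j : ℕ) + Xlt x j) *
        ((α j : ℂ) * (q : ℂ) ^ (x j + 1) - 1) *
        ((q : ℂ) ^ Xlt (incr x j) i * (1 - (q : ℂ) ^ incr x j i) * f (decr (incr x j) i)) -
      q * ((q : ℂ) ^ Xlt x i * (1 - (q : ℂ) ^ x i) *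
        (((Apar α j : ℝ) : ℂ) * (q : ℂ) ^ ((j : ℕ) + Xlt (decr x i) j) *
        ((α j : ℂ) * (q : ℂ) ^ (decr x i j + 1) - 1) * f (incr (decr x i) j))) =
      if i = j then (1 - q) * (((Apar α ((j : ℕ) + 1) : ℝ) : ℂ) *
          (q : ℂ) ^ ((j : ℕ) + 1 + 2 * Xlt x ((j : ℕ) + 1)) -
        ((Apar α j : ℝ) : ℂ) * (q : ℂ) ^ ((j : ℕ) + 2 * Xlt x j)) * f x else 0 := by
    intro j i
    by_cases hij : i = j
    · subst hij
      rw [if_pos rfl, Lop_raise_term_self]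
    · rw [if_neg hij, Lop_raise_term_of_ne q α f x hij, sub_self]
  simp only [key, Finset.sum_ite_eq', Finset.mem_univ, if_true]
  rw [← Finset.sum_mul, ← Finset.mul_sum,
    Fin.sum_univ_eq_sum_range (fun j => ((Apar α (j + 1) : ℝ) : ℂ) *
      (q : ℂ) ^ (j + 1 + 2 * Xlt x (j + 1)) - ((Apar α j : ℝ) : ℂ) * (q : ℂ) ^ (j + 2 * Xlt x j)) h,
    Finset.sum_range_sub (fun j => ((Apar α j : ℝ) : ℂ) * (q : ℂ) ^ (j + 2 * Xlt x j)), Xlt_top]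
  have hA : Apar α 0 = 1 := by simp [Apar]
  have hX : Xlt x 0 = 0 := by simp [Xlt]
  rw [hA, hX]
  simp [← Finset.mul_sum]

lemma Dop_eq {q : ℝ} (hq : q ≠ 0) {h : ℕ} (α : Fin h → ℝ) (N : ℕ) (f : (Fin h → ℕ) → ℂ)
    (x : Fin h → ℕ) :
    Dop q α N f x = ((q : ℂ) ^ N)⁻¹ * raise q (Lop q α f) x + eigval q α N * f x := by
  have hq' : (q : ℂ) ≠ 0 := by exact_mod_cast hq
  rw [Dop, eigval, add_mul _ _ (f x), ← add_assoc]
  congr 1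
  have key : ∀ i j : Fin h, ((q : ℂ) ^ N)⁻¹ * ((q : ℂ) ^ Xlt x i * (1 - (q : ℂ) ^ x i) *
        (((Apar α j : ℝ) : ℂ) * (q : ℂ) ^ ((j : ℕ) + Xlt (decr x i) j) *
        ((α j : ℂ) * (q : ℂ) ^ (decr x i j + 1) - 1) * f (incr (decr x i) j))) =
      (if i ≠ j then
        ((Apar α j : ℝ) : ℂ) *
          (q : ℂ) ^ ((((j : ℕ) + Xlt x j + Xlt x i : ℕ) : ℤ) - N -
            (if (i : ℕ) < (j : ℕ) then 1 else 0)) *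
          ((α j : ℂ) * (q : ℂ) ^ (x j + 1) - 1) * (1 - (q : ℂ) ^ (x i)) *
          f (Function.update (Function.update x j (x j + 1)) i (x i - 1))
      else 0) + if j = i then
        ((Apar α j : ℝ) : ℂ) * (q : ℂ) ^ ((((j : ℕ) + 2 * Xlt x j : ℕ) : ℤ) - N) *
            ((α j : ℂ) * (q : ℂ) ^ (x j) - 1) * (1 - (q : ℂ) ^ (x j)) * f x else 0 := by
    intro i j
    by_cases hx : x i = 0
    · by_cases hij : j = i
      · subst hij; simp [hx]
      · simp [hx, hij]
    by_cases hij : j = i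
    · subst hij
      obtain ⟨y, rfl⟩ : ∃ y, x = incr y j := ⟨_, (incr_decr x j hx).symm⟩
      simp only [decr_incr, Xlt_incr, incr_self, lt_irrefl, if_false, if_true, add_zero, ne_eq,
        not_true_eq_false, zero_add, zpow_sub₀ hq', zpow_natCast]
      ring
    · have e : Function.update (Function.update x j (x j + 1)) i (x i - 1) = incr (decr x i) j := by
        rw [← decr_incr_of_ne x (Ne.symm hij)]
        simp [decr, incr, Ne.symm hij]
      rw [e, if_pos (Ne.symm hij), if_neg hij, add_zero]
      obtain ⟨y, rfl⟩ : ∃ y, x = incr y i := ⟨_, (incr_decr x i hx).symm⟩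
      simp only [decr_incr, Xlt_incr, incr_self, incr_of_ne y hij, lt_irrefl, if_false, add_zero]
      split_ifs
      · rw [zpow_sub₀ hq', zpow_sub₀ hq', zpow_natCast, zpow_natCast, zpow_one]
        field_simp
        ring
      · rw [sub_zero, zpow_sub₀ hq', zpow_natCast, zpow_natCast]
        ring
  simp only [raise, Lop_apply, Finset.mul_sum, key, Finset.sum_add_distrib]
  rw [Finset.sum_mul]
  congr 1
  simp

lemma eigval_sub {q : ℝ} (hq : q ≠ 0) {h : ℕ} (α : Fin h → ℝ) (N : ℕ) :
    (1 - q) * (((Apar α h : ℝ) : ℂ) * (q : ℂ) ^ (h + 2 * N) - 1) =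
      (q : ℂ) ^ (N + 1) * (eigval q α N - eigval q α (N + 1)) := by
  have hq' : (q : ℂ) ≠ 0 := by exact_mod_cast hq
  simp only [eigval, zpow_sub₀ hq', zpow_neg, zpow_natCast, zpow_one]
  field_simp
  ring

/-- `f` lies in the kernel of the lowering operator on level `n`. -/
def IsLowest (q : ℝ) {h : ℕ} (α : Fin h → ℝ) (n : ℕ) (f : (Fin h → ℕ) → ℂ) : Prop :=
  ∀ x : Fin h → ℕ, (∑ i, x i) + 1 = n → Lop q α f x = 0

lemma Lop_raise_iterate {q : ℝ} (hq : q ≠ 0) {h : ℕ} {α : Fin h → ℝ} {n : ℕ}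
    {g : (Fin h → ℕ) → ℂ} (hg : IsLowest q α n g) (k : ℕ) (x : Fin h → ℕ)
    (hx : ∑ i, x i = n + k) :
    Lop q α ((raise q)^[k + 1] g) x =
      (q : ℂ) ^ (n + k + 1) * (eigval q α n - eigval q α (n + k + 1)) * (raise q)^[k] g x := by
  induction k generalizing x with
  | zero =>
    rw [Function.iterate_succ_apply', Lop_raise, raise_eq_zero, hx, eigval_sub hq]
    · simp
    · intro y hy
      exact hg y (by omega)
  | succ k ih =>
    rw [Function.iterate_succ_apply', Lop_raise, hx, eigval_sub hq]
    rw [raise_congr q (g := ((q : ℂ) ^ (n + k + 1) * (eigval q α n - eigval q α (n + k + 1))) •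
      (raise q)^[k] g) (fun y hy => ih y (by omega)), raise_smul, Pi.smul_apply, smul_eq_mul,
      ← Function.iterate_succ_apply' (raise q) k]
    rw [show n + (k + 1) = n + k + 1 by ring]
    ring

lemma Dop_raise_iterate {q : ℝ} (hq : q ≠ 0) {h : ℕ} {α : Fin h → ℝ} {n : ℕ}
    {g : (Fin h → ℕ) → ℂ} (hg : IsLowest q α n g) (k : ℕ) (x : Fin h → ℕ)
    (hx : ∑ i, x i = n + k) :
    Dop q α (n + k) ((raise q)^[k] g) x = eigval q α n * (raise q)^[k] g x := by
  have hq' : (q : ℂ) ≠ 0 := by exact_mod_cast hq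
  rw [Dop_eq hq]
  cases k with
  | zero =>
    rw [raise_eq_zero]
    · simp
    · intro y hy
      exact hg y (by omega)
  | succ k =>
    rw [raise_congr q (g := ((q : ℂ) ^ (n + k + 1) * (eigval q α n - eigval q α (n + k + 1))) •
      (raise q)^[k] g) (fun y hy => Lop_raise_iterate hq hg k y (by omega)), raise_smul,
      Pi.smul_apply, smul_eq_mul, ← Function.iterate_succ_apply' (raise q) k,
      show n + (k + 1) = n + k + 1 by ring]
    field_simp
    ring

lemma Dop_smul {q : ℝ} (hq : q ≠ 0) {h : ℕ} (α : Fin h → ℝ) (N : ℕ) (c : ℂ)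
    (f : (Fin h → ℕ) → ℂ) : Dop q α N (c • f) = c • Dop q α N f := by
  funext x
  rw [Pi.smul_apply, Dop_eq hq, Dop_eq hq, Lop_smul, raise_smul]
  simp only [Pi.smul_apply, smul_eq_mul]
  ring

lemma qPoch_succ (q a : ℝ) (m : ℕ) : qPoch q a (m + 1) = qPoch q a m * (1 - a * q ^ m) := by
  simp [qPoch, Finset.prod_range_succ]

lemma qPoch_self_pos {q : ℝ} (hq0 : 0 < q) (hq1 : q < 1) (m : ℕ) : 0 < qPoch q q m := by
  refine Finset.prod_pos fun k _ => ?_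
  rw [← pow_succ']
  exact sub_pos.2 (pow_lt_one₀ hq0.le hq1 (by simp))

lemma weight_incr {q : ℝ} (hq0 : 0 < q) (hq1 : q < 1) {h : ℕ} {α : Fin h → ℝ}
    (hα : ∀ i, 0 < α i) (N : ℕ) (x : Fin h → ℕ) (i : Fin h) :
    weight q α (N + 1) (incr x i) * (1 - q ^ (x i + 1)) =
      weight q α N x * (Apar α i * q ^ (i : ℕ)) * (1 - α i * q ^ (x i + 1)) := by
  have hA : Apar α i * q ^ (i : ℕ) = ∏ j : Fin h, if (j : ℕ) < i then α j * q else 1 := by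
    have hqi : q ^ (i : ℕ) = ∏ j : Fin h, if (j : ℕ) < i then q else 1 := by
      rw [Fin.prod_univ_eq_prod_range (fun j => if j < (i : ℕ) then q else 1) h,
        Finset.prod_ite, Finset.prod_const, Finset.prod_const_one, mul_one]
      congr 1
      have : Finset.filter (fun j => j < (i : ℕ)) (Finset.range h) = Finset.range i := by
        ext j
        have := i.2
        simp only [Finset.mem_filter, Finset.mem_range]
        omega
      rw [this, Finset.card_range]
    rw [hqi, Apar, ← Finset.prod_mul_distrib]
    exact Finset.prod_congr rfl fun j _ => by split_ifs <;> simp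
  have hs : ∀ c : ℝ, c = ∏ j : Fin h, if j = i then c else 1 := fun c => by simp
  rw [hA, hs (1 - q ^ (x i + 1)), hs (1 - α i * q ^ (x i + 1)), weight, weight,
    ← Finset.prod_mul_distrib, ← Finset.prod_mul_distrib, ← Finset.prod_mul_distrib]
  refine Finset.prod_congr rfl fun j _ => ?_
  have hαq : α j * q ≠ 0 := (mul_pos (hα j) hq0).ne'
  rw [Xlt_incr]
  by_cases hj : j = i
  · subst hj
    rw [incr_self, qPoch_succ, qPoch_succ]
    have h1 := (qPoch_self_pos hq0 hq1 (x j)).ne'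
    have h2 := (qPoch_self_pos hq0 hq1 (x j + 1)).ne'
    rw [qPoch_succ] at h2
    have h3 := right_ne_zero_of_mul h2
    simp only [Nat.lt_succ_self, if_true, lt_irrefl, if_false]
    rw [show ((N + 1 : ℕ) : ℤ) - ((Xlt x (j + 1) + 1 : ℕ) : ℤ) = (N : ℤ) - Xlt x (j + 1) by
      push_cast; ring, pow_succ' q (x j)]
    field_simp
  · rw [incr_of_ne x hj, if_neg hj, if_neg hj]
    rcases lt_or_gt_of_ne (fun e => hj (Fin.ext e) : (j : ℕ) ≠ i) with hlt | hlt
    · rw [if_neg (by omega), if_pos hlt, show ((N + 1 : ℕ) : ℤ) - ((Xlt x (j + 1) + 0 : ℕ) : ℤ) =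
        ((N : ℤ) - Xlt x (j + 1)) + 1 by push_cast; ring, zpow_add₀ hαq, zpow_one]
      ring
    · rw [if_pos (by omega), if_neg (by omega), show ((N + 1 : ℕ) : ℤ) -
        ((Xlt x (j + 1) + 1 : ℕ) : ℤ) = (N : ℤ) - Xlt x (j + 1) by push_cast; ring]
      ring

lemma sum_antidiagonalTuple_succ {h : ℕ} (N : ℕ) (i : Fin h) (F : (Fin h → ℕ) → ℂ)
    (hF : ∀ y, y i = 0 → F y = 0) :
    ∑ y ∈ Finset.Nat.antidiagonalTuple h (N + 1), F y =
      ∑ x ∈ Finset.Nat.antidiagonalTuple h N, F (incr x i) := by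
  refine (Finset.sum_of_injOn (fun x => incr x i) ?_ ?_ ?_ fun _ _ => rfl).symm
  · intro x _ y _ hxy
    rw [← decr_incr x i, ← decr_incr y i]
    exact congrArg (fun z => decr z i) hxy
  · intro x hx
    rw [Finset.mem_coe, Finset.Nat.mem_antidiagonalTuple] at hx ⊢
    rw [sum_incr, hx]
  · intro y hy hny
    refine hF y (by_contra fun h0 => hny ⟨decr y i, ?_, incr_decr y i h0⟩)
    rw [Finset.Nat.mem_antidiagonalTuple] at hy
    rw [Finset.mem_coe, Finset.Nat.mem_antidiagonalTuple]
    have := sum_decr y i h0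
    omega

/-- Up to sign, the raising and lowering operators are adjoint. -/
lemma form_raise_left {q : ℝ} (hq0 : 0 < q) (hq1 : q < 1) {h : ℕ} {α : Fin h → ℝ}
    (hα : ∀ i, 0 < α i) (N : ℕ) (f g : (Fin h → ℕ) → ℂ) :
    form q α (N + 1) (raise q f) g = -form q α N f (Lop q α g) := by
  have e1 : form q α (N + 1) (raise q f) g = ∑ i : Fin h,
      ∑ y ∈ Finset.Nat.antidiagonalTuple h (N + 1), (weight q α (N + 1) y : ℂ) *
        ((q : ℂ) ^ Xlt y i * (1 - (q : ℂ) ^ y i) * f (decr y i)) * (starRingEnd ℂ) (g y) := by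
    rw [Finset.sum_comm]
    simp only [form, raise, Finset.mul_sum, Finset.sum_mul]
  have e2 : -form q α N f (Lop q α g) = ∑ i : Fin h,
      ∑ x ∈ Finset.Nat.antidiagonalTuple h N, -((weight q α N x : ℂ) * f x *
        (((Apar α i : ℝ) : ℂ) * (q : ℂ) ^ ((i : ℕ) + Xlt x i) *
      ((α i : ℂ) * (q : ℂ) ^ (x i + 1) - 1) * (starRingEnd ℂ) (g (incr x i)))) := by
    rw [Finset.sum_comm]
    simp only [form, Lop_apply, map_sum, map_mul, map_sub, map_pow, Complex.conj_ofReal, map_one,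
      Finset.mul_sum, Finset.sum_neg_distrib]
  rw [e1, e2]
  refine Finset.sum_congr rfl fun i _ => ?_
  rw [sum_antidiagonalTuple_succ N i _ (fun y hy => by simp [hy])]
  refine Finset.sum_congr rfl fun x _ => ?_
  have hw := congrArg (fun r : ℝ => (r : ℂ)) (weight_incr hq0 hq1 hα N x i)
  push_cast at hw
  rw [decr_incr, incr_self, Xlt_incr, if_neg (lt_irrefl _), add_zero]
  linear_combination ((q : ℂ) ^ Xlt x i * f x * (starRingEnd ℂ) (g (incr x i))) * hw

lemma form_conj (q : ℝ) {h : ℕ} (α : Fin h → ℝ) (N : ℕ) (f g : (Fin h → ℕ) → ℂ) :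
    (starRingEnd ℂ) (form q α N f g) = form q α N g f := by
  simp only [form, map_sum, map_mul, Complex.conj_ofReal, Complex.conj_conj]
  exact Finset.sum_congr rfl fun x _ => by ring

lemma form_smul_left (q : ℝ) {h : ℕ} (α : Fin h → ℝ) (N : ℕ) (c : ℂ) (f g : (Fin h → ℕ) → ℂ) :
    form q α N (c • f) g = c * form q α N f g := by
  simp only [form, Finset.mul_sum, Pi.smul_apply, smul_eq_mul]
  exact Finset.sum_congr rfl fun x _ => by ring

lemma form_smul_right (q : ℝ) {h : ℕ} (α : Fin h → ℝ) (N : ℕ) (c : ℂ) (f g : (Fin h → ℕ) → ℂ) :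
    form q α N f (c • g) = (starRingEnd ℂ) c * form q α N f g := by
  rw [← form_conj, form_smul_left, map_mul, form_conj]

lemma form_congr_right (q : ℝ) {h : ℕ} (α : Fin h → ℝ) (N : ℕ) {f g g' : (Fin h → ℕ) → ℂ}
    (hg : ∀ x : Fin h → ℕ, ∑ i, x i = N → g x = g' x) :
    form q α N f g = form q α N f g' :=
  Finset.sum_congr rfl fun x hx => by rw [hg x (Finset.Nat.mem_antidiagonalTuple.1 hx)]

lemma form_zero_right (q : ℝ) {h : ℕ} (α : Fin h → ℝ) (N : ℕ) (f : (Fin h → ℕ) → ℂ) :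
    form q α N f 0 = 0 := by simp [form]

lemma innerV_eq (q : ℝ) {h : ℕ} (α : Fin h → ℝ) (N : ℕ) (f g : (Fin h → ℕ) → ℂ) :
    innerV q α N f g = (q : ℂ) ^ (N * (N + 1) / 2) * form q α N f g := by
  simp [innerV, form, weight]

lemma form_raise_iterate_succ {q : ℝ} (hq0 : 0 < q) (hq1 : q < 1) {h : ℕ} {α : Fin h → ℝ}
    (hα : ∀ i, 0 < α i) {m : ℕ} {g : (Fin h → ℕ) → ℂ} (hg : IsLowest q α (m + 1) g) (b : ℕ)
    (f : (Fin h → ℕ) → ℂ) :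
    form q α (m + 1 + b) ((raise q)^[b + 1] f) ((raise q)^[b] g) = 0 := by
  induction b with
  | zero =>
    rw [add_zero, Function.iterate_succ_apply', form_raise_left hq0 hq1 hα,
      Function.iterate_zero_apply, Function.iterate_zero_apply,
      form_congr_right q α m (g' := 0) (fun x hx => hg x (by omega)), form_zero_right, neg_zero]
  | succ b ih =>
    rw [Function.iterate_succ_apply', ← add_assoc, form_raise_left hq0 hq1 hα,
      form_congr_right q α (m + 1 + b) (g' := (_ : ℂ) • (raise q)^[b] g)
        (fun x hx => Lop_raise_iterate hq0.ne' hg b x hx), form_smul_right, ih]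
    simp

lemma form_raise_iterate_of_lt {q : ℝ} (hq0 : 0 < q) (hq1 : q < 1) {h : ℕ} {α : Fin h → ℝ}
    (hα : ∀ i, 0 < α i) {n m N : ℕ} (hnm : n < m) (hm : m ≤ N) {g : (Fin h → ℕ) → ℂ}
    (hg : IsLowest q α m g) (f : (Fin h → ℕ) → ℂ) :
    form q α N ((raise q)^[N - n] f) ((raise q)^[N - m] g) = 0 := by
  obtain ⟨m, rfl⟩ : ∃ k, m = k + 1 := ⟨m - 1, by omega⟩
  have e : N - n = (N - (m + 1) + 1) + (m - n) := by omega
  have := form_raise_iterate_succ hq0 hq1 hα hg (N - (m + 1)) ((raise q)^[m - n] f)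
  rwa [← Function.iterate_add_apply, ← e, show m + 1 + (N - (m + 1)) = N by omega] at this

lemma weight_definite {q : ℝ} (hq0 : 0 < q) (hq1 : q < 1) {h : ℕ} {α : Fin h → ℝ}
    (hα : ∀ i, 0 < α i) {N : ℕ}
    (hparam : (∀ i, α i < q⁻¹) ∨ (∀ i, (q : ℝ) ^ (-(N : ℤ)) < α i)) {M : ℕ} (hM : M ≤ N) :
    ∃ s : ℝ, s ≠ 0 ∧ ∀ x : Fin h → ℕ, ∑ i, x i = M → 0 < s * weight q α M x := by
  rcases hparam with hp | hp
  · refine ⟨1, one_ne_zero, fun x _ => ?_⟩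
    rw [one_mul]
    refine Finset.prod_pos fun i _ => mul_pos (div_pos ?_ (qPoch_self_pos hq0 hq1 _))
      (zpow_pos (mul_pos (hα i) hq0) _)
    refine Finset.prod_pos fun k _ => ?_
    have h1 : q * α i < 1 := by
      have := mul_lt_mul_of_pos_left (hp i) hq0
      rwa [mul_inv_cancel₀ hq0.ne'] at this
    have h2 : q ^ k ≤ 1 := pow_le_one₀ hq0.le hq1.le
    have h3 : 0 < q ^ k := pow_pos hq0 k
    have h4 : 0 < q * α i := mul_pos hq0 (hα i)
    nlinarith
  · refine ⟨(-1) ^ M, pow_ne_zero _ (by norm_num), fun x hx => ?_⟩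
    rw [← hx, weight, ← Finset.prod_pow_eq_pow_sum, ← Finset.prod_mul_distrib]
    refine Finset.prod_pos fun i _ => ?_
    rw [← mul_assoc, ← mul_div_assoc]
    refine mul_pos (div_pos ?_ (qPoch_self_pos hq0 hq1 _)) (zpow_pos (mul_pos (hα i) hq0) _)
    have hxi : x i ≤ N := (Finset.single_le_sum (f := x) (fun _ _ => Nat.zero_le _)
      (Finset.mem_univ i)).trans (hx.le.trans hM)
    have hc : ((-1 : ℝ)) ^ x i = ∏ _k ∈ Finset.range (x i), (-1 : ℝ) := by simp
    rw [hc, qPoch, ← Finset.prod_mul_distrib]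
    refine Finset.prod_pos fun k hk => ?_
    rw [Finset.mem_range] at hk
    have h1 : (q ^ N)⁻¹ < α i := by simpa using hp i
    have h2 : 1 < q ^ N * α i := by
      have := mul_lt_mul_of_pos_left h1 (pow_pos hq0 N)
      rwa [mul_inv_cancel₀ (pow_pos hq0 N).ne'] at this
    have h3 : q ^ N ≤ q ^ (k + 1) := pow_le_pow_of_le_one hq0.le hq1.le (by omega)
    have h4 := mul_le_mul_of_nonneg_right h3 (hα i).le
    rw [pow_succ'] at h4
    nlinarith

/-- Every function on level `M + 1` is the sum of a lowest one and a raised one. -/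
lemma exists_isLowest_add_raise {q : ℝ} (hq0 : 0 < q) (hq1 : q < 1) {h : ℕ} {α : Fin h → ℝ}
    (hα : ∀ i, 0 < α i) {N : ℕ}
    (hparam : (∀ i, α i < q⁻¹) ∨ (∀ i, (q : ℝ) ^ (-(N : ℤ)) < α i)) {M : ℕ} (hM : M + 1 ≤ N)
    (F : (Fin h → ℕ) → ℂ) :
    ∃ f G : (Fin h → ℕ) → ℂ, IsLowest q α (M + 1) f ∧
      ∀ x : Fin h → ℕ, ∑ i, x i = M + 1 → F x = f x + raise q G x := by
  obtain ⟨s, hs0, hs⟩ := weight_definite hq0 hq1 hα hparam hM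
  obtain ⟨s', -, hs'⟩ := weight_definite hq0 hq1 hα hparam ((Nat.le_succ M).trans hM)
  set r : (Fin h → ℕ) → ℝ := fun x => √(s * weight q α (M + 1) x)
  have hrr : ∀ x : Fin h → ℕ, ∑ i, x i = M + 1 →
      (r x : ℂ) * r x = s * (weight q α (M + 1) x : ℂ) := fun x hx => by
    exact_mod_cast Real.mul_self_sqrt (hs x hx).le
  let T : ((Fin h → ℕ) → ℂ) →ₗ[ℂ]
      EuclideanSpace ℂ (Finset.Nat.antidiagonalTuple h (M + 1)) :=
    { toFun := fun G => WithLp.toLp 2 fun x => (r x : ℂ) * raise q G x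
      map_add' := fun G G' => by
        ext x
        simp [raise_add, mul_add]
      map_smul' := fun c G => by
        ext x
        simp [raise_smul]
        ring }
  obtain ⟨y, ⟨G, rfl⟩, z, hz, hyz⟩ := (LinearMap.range T).exists_add_mem_mem_orthogonal
    (WithLp.toLp 2 fun x : Finset.Nat.antidiagonalTuple h (M + 1) => (r x : ℂ) * F x)
  have hFx : ∀ x : Fin h → ℕ, ∑ i, x i = M + 1 →
      ∀ hx : x ∈ Finset.Nat.antidiagonalTuple h (M + 1),
      z ⟨x, hx⟩ = (r x : ℂ) * (F x - raise q G x) := fun x _ hx => by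
    have := congrArg (fun v => v ⟨x, hx⟩) hyz
    simp only [T, LinearMap.coe_mk, AddHom.coe_mk, PiLp.add_apply] at this
    linear_combination -this
  refine ⟨F - raise q G, G, ?_, fun x _ => by simp⟩
  have horth : ∀ G', form q α (M + 1) (raise q G') (F - raise q G) = 0 := by
    intro G'
    have h0 := (Submodule.mem_orthogonal' _ _).1 hz (T G') ⟨G', rfl⟩
    rw [PiLp.inner_apply] at h0
    have hsum : (s : ℂ) * form q α (M + 1) (raise q G') (F - raise q G) = 0 := by
      rw [← h0, form, ← Finset.sum_coe_sort, Finset.mul_sum]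
      refine Finset.sum_congr rfl fun x _ => ?_
      have hx := Finset.Nat.mem_antidiagonalTuple.1 x.2
      rw [RCLike.inner_apply, show z x = _ from hFx x hx x.2, map_mul, Complex.conj_ofReal]
      simp only [T, LinearMap.coe_mk, AddHom.coe_mk, Pi.sub_apply]
      linear_combination (-(raise q G' x * (starRingEnd ℂ) (F x - raise q G x))) * hrr x hx
    exact (mul_eq_zero.1 hsum).resolve_left (by exact_mod_cast hs0)
  intro x hx
  have h1 := form_raise_left hq0 hq1 hα M (Pi.single x 1) (F - raise q G)
  rw [horth, form, Finset.sum_eq_single x] at h1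
  · have hw := (right_ne_zero_of_mul (hs' x (by omega)).ne')
    simpa [hw] using h1
  · intro y _ hy
    simp [hy]
  · intro hx'
    exact absurd (Finset.Nat.mem_antidiagonalTuple.2 (by omega)) hx'

lemma Rop_sum (q : ℝ) {h : ℕ} (M : ℕ) (s : Finset ℕ) (f : ℕ → (Fin h → ℕ) → ℂ) :
    Rop q M (∑ n ∈ s, f n) = ∑ n ∈ s, Rop q M (f n) := by
  funext x
  simp only [Rop, Finset.sum_apply, Finset.mul_sum]
  exact Finset.sum_comm

lemma exists_sum_RopIter {q : ℝ} (hq0 : 0 < q) (hq1 : q < 1) {h : ℕ} {α : Fin h → ℝ}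
    (hα : ∀ i, 0 < α i) {N : ℕ}
    (hparam : (∀ i, α i < q⁻¹) ∨ (∀ i, (q : ℝ) ^ (-(N : ℤ)) < α i)) {M : ℕ} (hM : M ≤ N)
    (F : (Fin h → ℕ) → ℂ) :
    ∃ g : ℕ → (Fin h → ℕ) → ℂ, (∀ n ≤ M, IsLowest q α n (g n)) ∧
      ∀ x : Fin h → ℕ, ∑ i, x i = M →
        F x = ∑ n ∈ Finset.range (M + 1), RopIter q n (M - n) (g n) x := by
  induction M generalizing F with
  | zero =>
    refine ⟨fun _ => F, fun n hn x hx => by omega, fun x _ => ?_⟩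
    simp [RopIter]
  | succ M ih =>
    obtain ⟨f, G, hf, hF⟩ := exists_isLowest_add_raise hq0 hq1 hα hparam hM F
    obtain ⟨g, hg, hG⟩ := ih ((Nat.le_succ M).trans hM) ((q : ℂ) ^ (M + 1) • G)
    have hq' : (q : ℂ) ≠ 0 := by exact_mod_cast hq0.ne'
    refine ⟨fun n => if n = M + 1 then f else g n, fun n hn => ?_, fun x hx => ?_⟩
    · by_cases h1 : n = M + 1
      · simpa [h1] using hf
      · simpa [h1] using hg n (by omega)
    · have hR : raise q G x = ∑ n ∈ Finset.range (M + 1), RopIter q n (M + 1 - n) (g n) x := by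
        have e1 : raise q G = Rop q M ((q : ℂ) ^ (M + 1) • G) := by
          rw [Rop_eq_smul_raise hq0.ne', raise_smul, smul_smul,
            inv_mul_cancel₀ (pow_ne_zero _ hq'), one_smul]
        have e2 : Rop q M ((q : ℂ) ^ (M + 1) • G) x =
            Rop q M (∑ n ∈ Finset.range (M + 1), RopIter q n (M - n) (g n)) x := by
          rw [Rop_eq_smul_raise hq0.ne', Rop_eq_smul_raise hq0.ne', Pi.smul_apply, Pi.smul_apply,
            raise_congr q (g := ∑ n ∈ Finset.range (M + 1), RopIter q n (M - n) (g n))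
              fun y hy => by rw [hG y (by omega), Finset.sum_apply]]
        rw [e1, e2, Rop_sum q, Finset.sum_apply]
        refine Finset.sum_congr rfl fun n hn => ?_
        have hn' := Finset.mem_range.1 hn
        rw [show M + 1 - n = (M - n) + 1 by omega, RopIter, show n + (M - n) = M by omega]
      rw [Finset.sum_range_succ, hF x hx, hR, add_comm]
      congr 1
      · refine Finset.sum_congr rfl fun n hn => ?_
        simp only [if_neg (Finset.mem_range.1 hn).ne]
      · simp [RopIter]

theorem stmt7 (q : ℝ) (hq0 : 0 < q) (hq1 : q < 1) (h : ℕ) (hh : 1 ≤ h)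
    (α : Fin h → ℝ) (hα : ∀ i, 0 < α i) (N : ℕ)
    (hparam : (∀ i, α i < q⁻¹) ∨ (∀ i, (q : ℝ) ^ (-(N : ℤ)) < α i)) :
    (∀ n, n ≤ N → ∀ g : (Fin h → ℕ) → ℂ,
      (n = 0 ∨ ∀ x : Fin h → ℕ, (∑ i, x i) + 1 = n → Lop q α g x = 0) →
      ∀ x : Fin h → ℕ, (∑ i, x i) = N →
        Dop q α N (RopIter q n (N - n) g) x =
          (q : ℂ) ^ (-(n : ℤ)) * (1 - (q : ℂ) ^ n) *
            (1 - ((Apar α h : ℝ) : ℂ) * (q : ℂ) ^ (((n + h : ℕ) : ℤ) - 1)) *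
            RopIter q n (N - n) g x) ∧
    (∀ n m : ℕ, n ≤ N → m ≤ N → n ≠ m →
      ∀ g₁ g₂ : (Fin h → ℕ) → ℂ,
        (n = 0 ∨ ∀ x : Fin h → ℕ, (∑ i, x i) + 1 = n → Lop q α g₁ x = 0) →
        (m = 0 ∨ ∀ x : Fin h → ℕ, (∑ i, x i) + 1 = m → Lop q α g₂ x = 0) →
        innerV q α N (RopIter q n (N - n) g₁) (RopIter q m (N - m) g₂) = 0) ∧
    (∀ F : (Fin h → ℕ) → ℂ, ∃ g : ℕ → (Fin h → ℕ) → ℂ,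
      (∀ n ≤ N, n = 0 ∨ ∀ x : Fin h → ℕ, (∑ i, x i) + 1 = n → Lop q α (g n) x = 0) ∧
      ∀ x : Fin h → ℕ, (∑ i, x i) = N →
        F x = ∑ n ∈ Finset.range (N + 1), RopIter q n (N - n) (g n) x) := by
  have hq : q ≠ 0 := hq0.ne'
  have hlow : ∀ n : ℕ, ∀ g : (Fin h → ℕ) → ℂ,
      (n = 0 ∨ ∀ x : Fin h → ℕ, (∑ i, x i) + 1 = n → Lop q α g x = 0) → IsLowest q α n g := by
    rintro n g (rfl | hg)
    · intro x hx
      omega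
    · exact hg
  refine ⟨fun n hn g hg x hx => ?_, fun n m hn hm hnm g₁ g₂ h₁ h₂ => ?_, fun F => ?_⟩
  · have hq' : (q : ℂ) ≠ 0 := by exact_mod_cast hq
    obtain ⟨c, hc⟩ := RopIter_eq_smul (h := h) hq n (N - n)
    have hD := Dop_raise_iterate hq (hlow n g hg) (N - n) x (by omega)
    rw [show n + (N - n) = N by omega] at hD
    have he : eigval q α n = (q : ℂ) ^ (-(n : ℤ)) * (1 - (q : ℂ) ^ n) *
        (1 - ((Apar α h : ℝ) : ℂ) * (q : ℂ) ^ (((n + h : ℕ) : ℤ) - 1)) := by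
      rw [eigval, add_comm h n, zpow_neg, zpow_natCast]
      field_simp
      ring
    rw [hc, Dop_smul hq, Pi.smul_apply, Pi.smul_apply, hD, ← he, smul_eq_mul, smul_eq_mul]
    ring
  · obtain ⟨c, hc⟩ := RopIter_eq_smul (h := h) hq n (N - n)
    obtain ⟨d, hd⟩ := RopIter_eq_smul (h := h) hq m (N - m)
    rw [innerV_eq, hc, hd, form_smul_left, form_smul_right]
    rcases lt_or_gt_of_ne hnm with hlt | hlt
    · rw [form_raise_iterate_of_lt hq0 hq1 hα hlt hm (hlow m g₂ h₂)]
      simp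
    · rw [← form_conj, form_raise_iterate_of_lt hq0 hq1 hα hlt hn (hlow n g₁ h₁)]
      simp
  · obtain ⟨g, hg, hF⟩ := exists_sum_RopIter hq0 hq1 hα hparam le_rfl F
    exact ⟨g, fun n hn => Or.inr (hg n hn), hF⟩
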